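/- Let R be a commutative ring, let n ≥ 1 and r ≥ 1 be integers, let M be a free R-module of rank n + r, and let N ⊆ M be a direct summand which is free of rank n and such that M/N is free of rank r. Let 1 ≤ d ≤ n, and let q : ⋀^d N ⊗_R ⋀^r M → ⋀^{d+r} M be the canonical map induced by the inclusion N ⊆ M and the wedge product. Then the kernel of q is the R-submodule generated by the elements (x ∧ x₁ ∧ … ∧ x_{d−1}) ⊗ (x ∧ y₁ ∧ … ∧ y_{r−1}) with x, x₁, …, x_{d−1} ∈ N and y₁, …, y_{r−1} ∈ M, where in the second tensor factor x is viewed in M via the inclusion. -/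

import Mathlib

open TensorProduct

/-- The canonical map `⋀^d N ⊗ ⋀^r M → ExteriorAlgebra R M` induced by the inclusion
`N ⊆ M` and the wedge product; its image lands in `⋀^{d+r} M`, and it sends
`(x₁∧…∧x_d) ⊗ (y₁∧…∧y_r)` to `x₁∧…∧x_d∧y₁∧…∧y_r`. -/
noncomputable def wedgeMulMap {R : Type*} [CommRing R]
    {M : Type*} [AddCommGroup M] [Module R M] (N : Submodule R M) (d r : ℕ) :
    (⋀[R]^d ↥N) ⊗[R] (⋀[R]^r M) →ₗ[R] ExteriorAlgebra R M :=
  (LinearMap.mul' R (ExteriorAlgebra R M)) ∘ₗ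
    TensorProduct.map
      ((ExteriorAlgebra.map N.subtype).toLinearMap ∘ₗ (⋀[R]^d (↥N)).subtype)
      ((⋀[R]^r M).subtype)

namespace WedgeKer

/-- The decomposable tensor attached to two tuples. -/
noncomputable def gen {R : Type*} [CommRing R] {M : Type*} [AddCommGroup M] [Module R M]
    {N : Submodule R M} {d r : ℕ} (v : Fin d → ↥N) (w : Fin r → M) :
    (⋀[R]^d ↥N) ⊗[R] (⋀[R]^r M) :=
  exteriorPower.ιMulti R d v ⊗ₜ[R] exteriorPower.ιMulti R r w

/-- The submodule of relations. -/
noncomputable def rel {R : Type*} [CommRing R] {M : Type*} [AddCommGroup M] [Module R M]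
    (N : Submodule R M) {d r : ℕ} (hd : 1 ≤ d) (hr : 1 ≤ r) :
    Submodule R ((⋀[R]^d ↥N) ⊗[R] (⋀[R]^r M)) :=
  Submodule.span R {t | ∃ (v : Fin d → ↥N) (w : Fin r → M),
    w ⟨0, hr⟩ = ↑(v ⟨0, hd⟩) ∧ t = gen v w}

lemma mem_of_add {R T : Type*} [CommRing R] [AddCommMonoid T] [Module R T] (S : Submodule R T)
    {a b : T} (ha : a ∈ S) (h : a + b ∈ S) : b ∈ S := by
  have h2 := S.add_mem (S.smul_mem (-1 : R) ha) h
  have h3 : (-1 : R) • a + (a + b) = b := by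
    rw [← add_assoc]
    nth_rewrite 2 [← one_smul R a]
    rw [← add_smul]
    simp
  rwa [h3] at h2

section
variable {R : Type*} [CommRing R] {M : Type*} [AddCommGroup M] [Module R M]
    {N : Submodule R M} {d r : ℕ}

lemma wedge_gen (v : Fin d → ↥N) (w : Fin r → M) :
    wedgeMulMap N d r (gen v w) =
      ExteriorAlgebra.ιMulti R (d + r) (Fin.append (fun i => (v i : M)) w) := by
  rw [← ExteriorAlgebra.ιMulti_mul_ιMulti]
  simp [wedgeMulMap, gen, ExteriorAlgebra.map_apply_ιMulti, Function.comp_def]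

lemma rel_le (hd : 1 ≤ d) (hr : 1 ≤ r) : rel N hd hr ≤ LinearMap.ker (wedgeMulMap N d r) := by
  refine Submodule.span_le.2 ?_
  rintro _ ⟨v, w, h, rfl⟩
  rw [SetLike.mem_coe, LinearMap.mem_ker, wedge_gen]
  refine AlternatingMap.map_eq_zero_of_eq _ _
    (i := Fin.castAdd r ⟨0, hd⟩) (j := Fin.natAdd d ⟨0, hr⟩) ?_ ?_
  · rw [Fin.append_left, Fin.append_right, h]
  · intro hh
    have := congrArg Fin.val hh
    simp at this
    omega

lemma gen_perm (v : Fin d → ↥N) (w : Fin r → M) (σ : Equiv.Perm (Fin d))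
    (τ : Equiv.Perm (Fin r)) (S : Submodule R ((⋀[R]^d ↥N) ⊗[R] (⋀[R]^r M)))
    (h : gen (v ∘ σ) (w ∘ τ) ∈ S) : gen v w ∈ S := by
  unfold gen at h ⊢
  rw [AlternatingMap.map_perm, AlternatingMap.map_perm] at h
  have key : ∀ {T : Type _} [AddCommGroup T] [Module R T] (ε : ℤˣ) (x : T),
      ε • x = ((ε : ℤ) : R) • x := by
    intro T _ _ ε x
    rw [Int.cast_smul_eq_zsmul]; rfl
  have key1 : ∀ ε : ℤˣ, IsUnit (((ε : ℤ) : R)) := fun ε => ε.isUnit.map (Int.castRingHom R)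
  rw [key, key, TensorProduct.smul_tmul_smul] at h
  exact (Submodule.smul_mem_iff_of_isUnit S ((key1 _).mul (key1 _))).1 h

lemma gen_mem_rel (hd : 1 ≤ d) (hr : 1 ≤ r) (v : Fin d → ↥N) (w : Fin r → M)
    (i : Fin d) (k : Fin r) (h : w k = v i) : gen v w ∈ rel N hd hr := by
  apply gen_perm v w (Equiv.swap ⟨0, hd⟩ i) (Equiv.swap ⟨0, hr⟩ k)
  apply Submodule.subset_span
  exact ⟨_, _, by simp [h], rfl⟩

lemma gen_swap (hd : 1 ≤ d) (hr : 1 ≤ r) (v : Fin d → ↥N) (w : Fin r → M)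
    (i : Fin d) (k : Fin r) (y : ↥N) (h : w k = y) :
    gen v w + gen (Function.update v i y) (Function.update w k (v i)) ∈ rel N hd hr := by
  have h1 : gen (Function.update v i (v i + y)) (Function.update w k (v i + y : M))
      ∈ rel N hd hr := gen_mem_rel hd hr _ _ i k (by simp)
  have h2 : gen (Function.update v i (v i)) (Function.update w k (v i : M))
      ∈ rel N hd hr := gen_mem_rel hd hr _ _ i k (by simp)
  have h3 : gen (Function.update v i y) (Function.update w k (y : M))
      ∈ rel N hd hr := gen_mem_rel hd hr _ _ i k (by simp)
  have h4 : gen v w = gen (Function.update v i (v i)) (Function.update w k (y : M)) := by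
    rw [← h]; simp
  rw [h4]
  refine mem_of_add _ h2 (mem_of_add _ h3 ?_)
  convert h1 using 1
  simp only [gen, AlternatingMap.map_update_add, TensorProduct.add_tmul, TensorProduct.tmul_add]
  ac_rfl

variable {k l : ℕ}

/-- Indices of standard basis elements. -/
abbrev Std (k l d r : ℕ) := {p : (Fin d → Fin k) × (Fin r → Fin (k + l)) //
  StrictMono (Fin.append (fun i => Fin.castAdd l (p.1 i)) p.2)}

lemma gen_mem (hd : 1 ≤ d) (hr : 1 ≤ r) (f : Module.Basis (Fin k) R N)
    (e : Module.Basis (Fin (k + l)) R M) (hef : ∀ i, e (Fin.castAdd l i) = f i)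
    (m : ℕ) : ∀ (v : Fin d → Fin k) (w : Fin r → Fin (k + l)), ∑ i, (v i : ℕ) = m →
      gen (f ∘ v) (e ∘ w) ∈ rel N hd hr ⊔
        Submodule.span R (Set.range fun p : Std k l d r => gen (f ∘ p.1.1) (e ∘ p.1.2)) := by
  induction m using Nat.strong_induction_on with
  | _ m ih =>
  intro v w hm
  by_cases hv : Function.Injective v
  swap
  · have : exteriorPower.ιMulti R d (f ∘ v) = 0 :=
      AlternatingMap.map_eq_zero_of_not_injective _ _ fun h => hv h.of_comp
    simp [gen, this]
  by_cases hw : Function.Injective w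
  swap
  · have : exteriorPower.ιMulti R r (e ∘ w) = 0 :=
      AlternatingMap.map_eq_zero_of_not_injective _ _ fun h => hw h.of_comp
    simp [gen, this]
  by_cases hvw : ∀ i j, Fin.castAdd l (v i) < w j
  · -- sorted
    refine gen_perm _ _ (Tuple.sort v) (Tuple.sort w) _ ?_
    apply Submodule.mem_sup_right
    apply Submodule.subset_span
    refine ⟨⟨(v ∘ Tuple.sort v, w ∘ Tuple.sort w), ?_⟩, rfl⟩
    have h1 : StrictMono (v ∘ Tuple.sort v) :=
      (Tuple.monotone_sort v).strictMono_of_injective (hv.comp (Equiv.injective _))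
    have h2 : StrictMono (w ∘ Tuple.sort w) :=
      (Tuple.monotone_sort w).strictMono_of_injective (hw.comp (Equiv.injective _))
    intro a b hab
    induction a using Fin.addCases with
    | left a =>
      induction b using Fin.addCases with
      | left b =>
        have : a < b := hab
        rw [Fin.append_left, Fin.append_left]
        exact h1 this
      | right b => simpa using hvw _ _
    | right a =>
      induction b using Fin.addCases with
      | left b =>
        exfalso
        have := Fin.lt_def.1 hab
        simp at this
        omega
      | right b =>
        have : a < b := by simpa using hab
        simpa using h2 this
  · push Not at hvw
    obtain ⟨i, j, hij⟩ := hvw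
    have hlt : (w j : ℕ) < k := lt_of_le_of_lt (Fin.le_def.1 hij) (by simp)
    obtain ⟨y, hy⟩ : ∃ y : Fin k, w j = Fin.castAdd l y := ⟨⟨w j, hlt⟩, rfl⟩
    have hey : (e ∘ w) j = (f y : M) := by simp [hy, hef]
    rcases hij.lt_or_eq with hij | hij
    · have h1 := gen_swap hd hr (f ∘ v) (e ∘ w) i j (f y) hey
      have e1 : Function.update (f ∘ v) i (f y) = f ∘ Function.update v i y := by
        rw [Function.comp_update]
      have e2 : Function.update (e ∘ w) j ((f ∘ v) i : M)
          = e ∘ Function.update w j (Fin.castAdd l (v i)) := by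
        rw [Function.comp_update, hef]; rfl
      rw [e1, e2] at h1
      have hyv : (y : ℕ) < v i := by
        rw [hy] at hij; exact hij
      have h2 := ih (∑ a, ((Function.update v i y) a : ℕ)) (by
        rw [← hm]
        refine Finset.sum_lt_sum (fun a _ => ?_) ⟨i, Finset.mem_univ _, by simpa using hyv⟩
        by_cases ha : a = i
        · subst ha; simpa using hyv.le
        · simp [ha]) (Function.update v i y) (Function.update w j (Fin.castAdd l (v i))) rfl
      rw [add_comm] at h1
      exact mem_of_add _ h2 (Submodule.mem_sup_left h1)
    · apply Submodule.mem_sup_left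
      apply gen_mem_rel hd hr _ _ i j
      simp [hij, hef]

lemma sup_eq_top (hd : 1 ≤ d) (hr : 1 ≤ r) (f : Module.Basis (Fin k) R N)
    (e : Module.Basis (Fin (k + l)) R M) (hef : ∀ i, e (Fin.castAdd l i) = f i) :
    rel N hd hr ⊔
      Submodule.span R (Set.range fun p : Std k l d r => gen (f ∘ p.1.1) (e ∘ p.1.2)) = ⊤ := by
  rw [eq_top_iff, ← ((f.exteriorPower d).tensorProduct (e.exteriorPower r)).span_eq,
    Submodule.span_le]
  rintro _ ⟨⟨s, t⟩, rfl⟩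
  rw [Module.Basis.tensorProduct_apply, exteriorPower.basis_apply, exteriorPower.basis_apply]
  exact gen_mem hd hr f e hef _ _ _ rfl

lemma indep (f : Module.Basis (Fin k) R N)
    (e : Module.Basis (Fin (k + l)) R M) (hef : ∀ i, e (Fin.castAdd l i) = f i) :
    LinearIndependent R (wedgeMulMap N d r ∘
      fun p : Std k l d r => gen (f ∘ p.1.1) (e ∘ p.1.2)) := by
  have h := (exteriorPower.ιMulti_family_linearIndependent_ofBasis R (d + r) e).map'
    (⋀[R]^(d + r) M).subtype (Submodule.ker_subtype _)
  have h' := h.comp (fun p : Std k l d r =>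
    Set.powersetCard.ofFinEmbEquiv (OrderEmbedding.ofStrictMono _ p.2)) (by
      intro p q hpq
      have h1 := Set.powersetCard.ofFinEmbEquiv.injective hpq
      have h2 : Fin.append (fun i => Fin.castAdd l (p.1.1 i)) p.1.2 =
        Fin.append (fun i => Fin.castAdd l (q.1.1 i)) q.1.2 := congrArg DFunLike.coe h1
      apply Subtype.ext
      apply Prod.ext
      · funext i
        have := congrFun h2 (Fin.castAdd r i)
        simpa using this
      · funext i
        have := congrFun h2 (Fin.natAdd d i)
        simpa using this)
  have hfun : (wedgeMulMap N d r ∘ fun p : Std k l d r => gen (f ∘ p.1.1) (e ∘ p.1.2)) =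
      ((⋀[R]^(d + r) M).subtype ∘ exteriorPower.ιMulti_family R (d + r) e) ∘
        fun p : Std k l d r =>
          Set.powersetCard.ofFinEmbEquiv (OrderEmbedding.ofStrictMono _ p.2) := by
    funext p
    simp only [Function.comp_apply, wedge_gen, Submodule.subtype_apply,
      exteriorPower.ιMulti_family_apply_coe, ExteriorAlgebra.ιMulti_family, Equiv.symm_apply_apply]
    congr 1
    funext a
    induction a using Fin.addCases with
    | left a => simp [hef]
    | right a => simp
  rw [hfun]
  exact h'

lemma ker_eq (hd : 1 ≤ d) (hr : 1 ≤ r) (f : Module.Basis (Fin k) R N)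
    (e : Module.Basis (Fin (k + l)) R M) (hef : ∀ i, e (Fin.castAdd l i) = f i) :
    LinearMap.ker (wedgeMulMap N d r) = rel N hd hr := by
  refine le_antisymm (fun t ht => ?_) (rel_le hd hr)
  have htop : t ∈ rel N hd hr ⊔ Submodule.span R
      (Set.range fun p : Std k l d r => gen (f ∘ p.1.1) (e ∘ p.1.2)) := by
    rw [sup_eq_top hd hr f e hef]; trivial
  obtain ⟨a, ha, b, hb, rfl⟩ := Submodule.mem_sup.1 htop
  have hb' : b ∈ LinearMap.ker (wedgeMulMap N d r) := mem_of_add _ (rel_le hd hr ha) ht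
  have := Submodule.disjoint_def.1 (Submodule.range_ker_disjoint (indep f e hef)) b hb hb'
  rwa [this, add_zero]

end

end WedgeKer

/-- Let `R` be a commutative ring, `n, r ≥ 1`, `M` a free `R`-module of
rank `n + r`, and `N ⊆ M` a direct summand which is free of rank `n` with `M/N` free of
rank `r`.  Let `1 ≤ d ≤ n` and let `q : ⋀^d N ⊗ ⋀^r M → ⋀^{d+r} M` be the canonical map.
Then `ker q` is generated by the elements
`(x ∧ x₁ ∧ … ∧ x_{d-1}) ⊗ (x ∧ y₁ ∧ … ∧ y_{r-1})` with `x, xᵢ ∈ N`, `yᵢ ∈ M`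
(encoded as `v : Fin d → N`, `w : Fin r → M` with `w 0 = v 0` in `M`). -/
theorem wedgeMulMap_ker
    {R : Type*} [CommRing R] (n r : ℕ) (hn : 1 ≤ n) (hr : 1 ≤ r)
    {M : Type*} [AddCommGroup M] [Module R M] [Module.Free R M] [Module.Finite R M]
    (hrankM : Module.finrank R M = n + r)
    (N : Submodule R M) (hcompl : ∃ N' : Submodule R M, IsCompl N N')
    [Module.Free R ↥N] (hrankN : Module.finrank R ↥N = n)
    [Module.Free R (M ⧸ N)] (hrankQ : Module.finrank R (M ⧸ N) = r)
    (d : ℕ) (hd1 : 1 ≤ d) (hdn : d ≤ n) :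
    LinearMap.ker (wedgeMulMap N d r) =
      Submodule.span R
        { t : (⋀[R]^d ↥N) ⊗[R] (⋀[R]^r M) |
          ∃ (v : Fin d → ↥N) (w : Fin r → M),
            w ⟨0, hr⟩ = ↑(v ⟨0, hd1⟩) ∧
            t = (⟨ExteriorAlgebra.ιMulti R d v,
                   ExteriorAlgebra.ιMulti_range R d (Set.mem_range_self v)⟩ : ⋀[R]^d ↥N)
                ⊗ₜ[R]
                (⟨ExteriorAlgebra.ιMulti R r w,
                   ExteriorAlgebra.ιMulti_range R r (Set.mem_range_self w)⟩ : ⋀[R]^r M) } := by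
  obtain ⟨N', hN'⟩ := hcompl
  have : Module.Finite R N := Module.Finite.of_surjective _ (Submodule.projectionOnto_surjective hN')
  have : Module.Free R N' := Module.Free.of_equiv (N.quotientEquivOfIsCompl N' hN')
  have : Module.Finite R N' :=
    Module.Finite.of_surjective _ (Submodule.projectionOnto_surjective hN'.symm)
  let f := (Module.Free.chooseBasis R N).reindex (Fintype.equivFin _)
  let g := (Module.Free.chooseBasis R N').reindex (Fintype.equivFin _)
  let e := ((f.prod g).map (N.prodEquivOfIsCompl N' hN')).reindex finSumFinEquiv
  exact WedgeKer.ker_eq hd1 hr f e (fun i => by simp [e])
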